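/- (Expansion of the first return map.) For every a ∈ X there exists ε>0 such that for each r ∈ ℂ with |r|<ε the Lipschitz solution v(·;r;a) of v′(x)=∑_{i=1}^∞ a_i(x)v(x)^{i+1} with v(0)=r exists on I_T and satisfies v(T;r;a) = r + ∑_{i=1}^∞ c_i(a) r^{i+1}, the series converging absolutely, where c_i(a) := ∑_{i_1+⋯+i_k=i} p_{i_1,…,i_k}(i) · I_{i_1,…,i_k}(a) (the sum over all multi-indices of positive integers with i_1+⋯+i_k=i). -/

import Mathlib

open MeasureTheory

noncomputable section

/-- The class `X`: sequences `a = (a₁, a₂, …)` of bounded measurable functions on `[0,T]`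
with `sup_{x,i} |aᵢ(x)|^{1/i} < ∞` (equivalently `‖aᵢ(x)‖ ≤ Cⁱ` for some `C`).
We index by `ℕ`, using only indices `i ≥ 1`. -/
def MemX (T : ℝ) (a : ℕ → ℝ → ℂ) : Prop :=
  (∀ i, Measurable (a i)) ∧
    ∃ C : ℝ, ∀ i : ℕ, 1 ≤ i → ∀ x ∈ Set.Icc (0 : ℝ) T, ‖a i x‖ ≤ C ^ i

/-- Auxiliary iterated integral: for the multi-index list `[j₁, …, jₖ]` (outermost first),
`itIntAux a [j₁,…,jₖ] x = ∫_{0 ≤ s_k ≤ … ≤ s_1 ≤ x} a_{j₁}(s₁)⋯a_{jₖ}(sₖ) ds`. -/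
def itIntAux (a : ℕ → ℝ → ℂ) : List ℕ → ℝ → ℂ
  | [], _ => 1
  | i :: l, x => ∫ s in (0 : ℝ)..x, a i s * itIntAux a l s

/-- The basic iterated integral `I_{i₁,…,iₖ}(a)` over `0 ≤ s₁ ≤ ⋯ ≤ sₖ ≤ T`,
with the multi-index encoded as the list `[i₁, …, iₖ]` (so the empty list gives `1`). -/
def itInt (T : ℝ) (a : ℕ → ℝ → ℂ) (l : List ℕ) : ℂ :=
  itIntAux a l.reverse T

/-- `v` is a Lipschitz solution on `[0,T]` of `v' = ∑_{i≥1} aᵢ(x) v^{i+1}`. -/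
def IsODESol (T : ℝ) (a : ℕ → ℝ → ℂ) (v : ℝ → ℂ) : Prop :=
  (∃ K : NNReal, LipschitzOnWith K v (Set.Icc 0 T)) ∧
    ∀ᵐ x ∂(volume.restrict (Set.Icc (0 : ℝ) T)),
      (Summable fun i : ℕ => ‖a (i + 1) x * v x ^ (i + 2)‖) ∧
        HasDerivAt v (∑' i : ℕ, a (i + 1) x * v x ^ (i + 2)) x

/-- The value `p_{i₁,…,iₖ}(t) = (t-i₁+1)(t-i₁-i₂+1)⋯(t-i₁-⋯-iₖ+1)` for the multi-index
`l = [i₁,…,iₖ]`. -/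
def pval (l : List ℕ) (t : ℂ) : ℂ :=
  ∏ j ∈ Finset.range l.length, (t - ((l.take (j + 1)).sum : ℂ) + 1)

/-- The coefficient `cᵢ(a) = ∑_{i₁+⋯+iₖ=i} p_{i₁,…,iₖ}(i) · I_{i₁,…,iₖ}(a)`, the sum over
all multi-indices of positive integers with `i₁+⋯+iₖ = i` (i.e. compositions of `i`). -/
def returnCoeff (T : ℝ) (a : ℕ → ℝ → ℂ) (i : ℕ) : ℂ :=
  ∑ comp : Composition i, pval comp.blocks (i : ℂ) * itInt T a comp.blocks

def DD (b : ℕ → ℝ → ℂ) : ℕ → ℕ → ℝ → ℂ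
  | 0, _, _ => 1
  | m + 1, q, x => ∫ s in (0 : ℝ)..x,
      (q : ℂ) * ∑ j : Fin (m + 1), b (j + 1) s * DD b (m - j) (q + j + 1) s
  termination_by m => m
  decreasing_by omega

def dDD (b : ℕ → ℝ → ℂ) : ℕ → ℕ → ℝ → ℂ
  | 0, _, _ => 0
  | m + 1, q, s => (q : ℂ) * ∑ p ∈ Finset.HasAntidiagonal.antidiagonal m, b (p.1 + 1) s * DD b p.2 (q + p.1 + 1) s

lemma DD_zero (b : ℕ → ℝ → ℂ) (q : ℕ) (x : ℝ) : DD b 0 q x = 1 := by rw [DD]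

lemma DD_succ (b : ℕ → ℝ → ℂ) (m q : ℕ) (x : ℝ) :
    DD b (m + 1) q x = ∫ s in (0 : ℝ)..x, dDD b (m + 1) q s := by
  rw [DD]
  congr 1
  ext s
  rw [dDD, Finset.Nat.sum_antidiagonal_eq_sum_range_succ_mk, Finset.sum_range]

lemma DD_eq (b : ℕ → ℝ → ℂ) (m q : ℕ) (x : ℝ) :
    DD b m q x = DD b m q 0 + ∫ s in (0 : ℝ)..x, dDD b m q s := by
  cases m with
  | zero => simp [DD_zero, dDD]
  | succ m => simp [DD_succ]

lemma DD_at_zero (b : ℕ → ℝ → ℂ) (m q : ℕ) : DD b m q 0 = if m = 0 then 1 else 0 := by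
  cases m with
  | zero => simp [DD_zero]
  | succ m => simp [DD_succ]

structure Good (T C : ℝ) (b : ℕ → ℝ → ℂ) : Prop where
  hT : 0 < T
  hC : 1 ≤ C
  meas : ∀ i, Measurable (b i)
  bd : ∀ i x, ‖b (i + 1) x‖ ≤ C ^ (i + 1)
  van : ∀ i x, x ∉ Set.Icc 0 T → b i x = 0

lemma dDD_van {T C : ℝ} {b : ℕ → ℝ → ℂ} (h : Good T C b) (m q : ℕ) (x : ℝ)
    (hx : x ∉ Set.Icc 0 T) : dDD b m q x = 0 := by
  cases m with
  | zero => simp [dDD]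
  | succ m => simp [dDD, h.van _ x hx]

lemma b_intOn {T C : ℝ} {b : ℕ → ℝ → ℂ} (h : Good T C b) (i : ℕ) :
    IntegrableOn (b (i + 1)) (Set.Icc 0 T) := by
  apply Measure.integrableOn_of_bounded (M := C ^ (i+1)) (by simp)
    (h.meas _).aestronglyMeasurable
  exact Filter.Eventually.of_forall (h.bd i)

lemma DD_main {T C : ℝ} {b : ℕ → ℝ → ℂ} (h : Good T C b) (m : ℕ) :
    ∀ q, Continuous (DD b m q) ∧ Integrable (dDD b m q) := by
  induction m using Nat.strong_induction_on with
  | _ m ih =>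
    intro q
    have hI : Integrable (dDD b m q) := by
      cases m with
      | zero => 
        have : dDD b 0 q = fun _ => 0 := by ext; simp [dDD]
        rw [this]; exact integrable_zero _ _ _
      | succ m =>
        have hs : Function.support (dDD b (m+1) q) ⊆ Set.Icc 0 T := by
          intro x hx
          by_contra hn
          exact hx (dDD_van h _ _ x hn)
        rw [← integrableOn_iff_integrable_of_support_subset hs]
        have : dDD b (m+1) q = fun s => (q : ℂ) * ∑ p ∈ Finset.HasAntidiagonal.antidiagonal m,
          b (p.1 + 1) s * DD b p.2 (q + p.1 + 1) s := by ext; simp [dDD]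
        rw [this]
        apply Integrable.const_mul
        apply integrable_finsetSum
        intro p hp
        have hp2 : p.2 < m + 1 := by
          have := Finset.HasAntidiagonal.mem_antidiagonal.1 hp
          omega
        exact (b_intOn h p.1).mul_continuousOn ((ih p.2 hp2 _).1.continuousOn) isCompact_Icc
    refine ⟨?_, hI⟩
    have : DD b m q = fun x => DD b m q 0 + ∫ s in (0 : ℝ)..x, dDD b m q s := by
      ext x; exact DD_eq b m q x
    rw [this]
    exact continuous_const.add (intervalIntegral.continuous_primitive (fun _ _ => hI.intervalIntegrable) 0)

lemma sum_bd (C : ℝ) (hC : 1 ≤ C) (m : ℕ) :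
    ∑ p ∈ Finset.HasAntidiagonal.antidiagonal m, C ^ (p.1 + 1) * (2 * C) ^ p.2 ≤ (2 * C) ^ (m + 1) := by
  have : ∀ p ∈ Finset.HasAntidiagonal.antidiagonal m, C ^ (p.1 + 1) * (2 * C) ^ p.2 = C ^ (m + 1) * 2 ^ p.2 := by
    intro p hp
    have := Finset.HasAntidiagonal.mem_antidiagonal.1 hp
    rw [← this]; ring
  rw [Finset.sum_congr rfl this, ← Finset.mul_sum, mul_pow, mul_comm]
  gcongr
  rw [← Finset.Nat.sum_antidiagonal_swap, Finset.Nat.sum_antidiagonal_eq_sum_range_succ_mk]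
  simp only [Prod.snd_swap]
  rw [geom_sum_eq (by norm_num)]
  norm_num

lemma DD_bd {T C : ℝ} {b : ℕ → ℝ → ℂ} (h : Good T C b) (m : ℕ) :
    ∀ q x, 0 ≤ x → ‖DD b m q x‖ ≤ (2 * C) ^ m * Real.exp ((q + m) * x) ∧
      ‖dDD b m q x‖ ≤ (2 * C) ^ m * (q * Real.exp ((q + m) * x)) := by
  have hC := h.hC
  induction m using Nat.strong_induction_on with
  | _ m ih =>
    cases m with
    | zero =>
      intro q x hx
      simp only [DD_zero, dDD]
      constructor
      · simp; positivity
      · rw [norm_zero]; positivity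
    | succ m =>
      have key : ∀ (q : ℕ) (x : ℝ), 0 ≤ x → ‖dDD b (m+1) q x‖ ≤
          (2 * C) ^ (m+1) * (q * Real.exp ((q + (m+1 : ℕ)) * x)) := by
        intro q x hx
        rw [dDD, norm_mul, Complex.norm_natCast]
        have h1 : ‖∑ p ∈ Finset.HasAntidiagonal.antidiagonal m, b (p.1 + 1) x * DD b p.2 (q + p.1 + 1) x‖ ≤
            ∑ p ∈ Finset.HasAntidiagonal.antidiagonal m, (C ^ (p.1 + 1) * (2 * C) ^ p.2) *
              Real.exp ((q + (m+1 : ℕ)) * x) := by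
          apply norm_sum_le_of_le
          intro p hp
          have hp' := Finset.HasAntidiagonal.mem_antidiagonal.1 hp
          have h2 := (ih p.2 (by omega) (q + p.1 + 1) x hx).1
          have h3 : ((q + p.1 + 1 : ℕ) : ℝ) + p.2 = q + (m + 1 : ℕ) := by
            rw [← hp']; push_cast; ring
          rw [h3] at h2
          rw [norm_mul, mul_assoc]
          exact mul_le_mul (h.bd _ _) h2 (norm_nonneg _) (by positivity)
        rw [← Finset.sum_mul] at h1
        have h4 := sum_bd C hC m
        calc _ ≤ (q : ℝ) * ((2 * C) ^ (m+1) * Real.exp ((q + (m+1 : ℕ)) * x)) := by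
              gcongr
              exact h1.trans (by gcongr)
          _ = _ := by ring
      intro q x hx
      refine ⟨?_, key q x hx⟩
      rw [DD_succ]
      have hd : ∀ s ∈ Set.uIcc 0 x, HasDerivAt
          (fun s => (2 * C) ^ (m+1) * Real.exp (((q : ℝ) + (m+1 : ℕ)) * s))
          ((2 * C) ^ (m+1) * ((q + (m+1 : ℕ)) * Real.exp ((q + (m+1 : ℕ)) * s))) s := by
        intro s _
        have := ((((hasDerivAt_id s).const_mul ((q : ℝ) + (m+1 : ℕ))).exp).const_mul ((2 * C) ^ (m+1)))
        convert! this using 1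
        simp only [id]
        ring
      have hint : IntervalIntegrable (fun s =>
          ((2 * C) ^ (m+1) * ((q + (m+1 : ℕ)) * Real.exp (((q : ℝ) + (m+1 : ℕ)) * s)))) volume 0 x := by
        apply Continuous.intervalIntegrable
        fun_prop
      have hv := intervalIntegral.integral_eq_sub_of_hasDerivAt hd hint
      calc _ ≤ ∫ s in (0:ℝ)..x, ((2 * C) ^ (m+1) * ((q + (m+1 : ℕ)) *
              Real.exp (((q : ℝ) + (m+1 : ℕ)) * s))) := by
            apply intervalIntegral.norm_integral_le_of_norm_le hx _ hint
            refine Filter.Eventually.of_forall fun s hs => (key q s hs.1.le).trans ?_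
            gcongr
            have : (0:ℝ) ≤ (m+1 : ℕ) := by positivity
            linarith
        _ ≤ _ := by
            rw [hv]
            have : 0 ≤ (2 * C) ^ (m + 1) * Real.exp ((↑q + ↑(m + 1)) * 0) := by positivity
            linarith

def Prim (T : ℝ) (f g : ℝ → ℂ) : Prop :=
  AbsolutelyContinuousOnInterval f 0 T ∧ ∀ᵐ x, HasDerivAt f (g x) x

lemma Prim.mul {T : ℝ} {f g f' g' : ℝ → ℂ} (h : Prim T f g) (h' : Prim T f' g') :
    Prim T (fun x => f x * f' x) (fun x => g x * f' x + f x * g' x) := by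
  refine ⟨h.1.smul h'.1, ?_⟩
  filter_upwards [h.2, h'.2] with x hx hx'
  exact hx.mul hx'

lemma Prim.sum {T : ℝ} {ι : Type} (s : Finset ι) {f g : ι → ℝ → ℂ} (h : ∀ i ∈ s, Prim T (f i) (g i)) :
    Prim T (fun x => ∑ i ∈ s, f i x) (fun x => ∑ i ∈ s, g i x) := by
  classical
  induction s using Finset.induction_on with
  | empty =>
    simp only [Finset.sum_empty]
    refine ⟨?_, Filter.Eventually.of_forall fun x => hasDerivAt_const _ _⟩
    exact ((LipschitzWith.const (0:ℂ)).lipschitzOnWith (s := Set.uIcc 0 T)).absolutelyContinuousOnInterval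
  | insert a s ha ih =>
    have h1 := h a (by simp)
    have h2 := ih (fun i hi => h i (by simp [hi]))
    simp only [Finset.sum_insert ha]
    refine ⟨h1.1.add h2.1, ?_⟩
    filter_upwards [h1.2, h2.2] with x hx hx'
    exact hx.add hx'

lemma Prim.unique {T : ℝ} (hT : 0 < T) {f g f' g' : ℝ → ℂ} (h : Prim T f g) (h' : Prim T f' g')
    (hg : ∀ x ∈ Set.Icc 0 T, g x = g' x) (h0 : f 0 = f' 0) : ∀ x ∈ Set.Icc 0 T, f x = f' x := by
  have hI : Set.uIcc 0 T = Set.Icc 0 T := Set.uIcc_of_le hT.le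
  obtain ⟨c, hc⟩ := (h.1.sub h'.1).const_of_ae_hasDerivAt_zero (by
    filter_upwards [h.2, h'.2] with x hx hx' hxI
    have := hx.sub hx'
    rwa [hg x (hI ▸ hxI), sub_self] at this)
  rw [hI] at hc
  intro x hx
  have h1 := hc x hx
  have h2 := hc 0 ⟨le_rfl, hT.le⟩
  simp only [Pi.sub_apply, h0, sub_self] at h1 h2
  rw [← h2] at h1
  exact sub_eq_zero.1 h1

lemma lip_prim {T M : ℝ} {g : ℝ → ℂ} (hM : 0 ≤ M) (hg : Integrable g)
    (hb : ∀ x ∈ Set.Icc 0 T, ‖g x‖ ≤ M) (c : ℂ) :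
    LipschitzOnWith (Real.toNNReal M) (fun x => c + ∫ s in (0:ℝ)..x, g s) (Set.Icc 0 T) := by
  apply LipschitzOnWith.of_dist_le_mul
  intro x hx y hy
  rw [dist_eq_norm, Real.coe_toNNReal _ hM, add_sub_add_left_eq_sub,
    intervalIntegral.integral_interval_sub_left hg.intervalIntegrable hg.intervalIntegrable,
    Real.dist_eq]
  apply intervalIntegral.norm_integral_le_of_norm_le_const
  intro s hs
  apply hb
  have := Set.uIoc_subset_uIcc hs
  exact (Set.uIcc_subset_Icc hy hx) this

lemma DD_prim {T C : ℝ} {b : ℕ → ℝ → ℂ} (h : Good T C b) (m q : ℕ) :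
    Prim T (DD b m q) (dDD b m q) := by
  have hC := h.hC
  have hi := (DD_main h m q).2
  have he : DD b m q = fun x => DD b m q 0 + ∫ s in (0 : ℝ)..x, dDD b m q s := by
    ext x; exact DD_eq b m q x
  refine ⟨?_, ?_⟩
  · rw [he]
    apply LipschitzOnWith.absolutelyContinuousOnInterval
    rw [Set.uIcc_of_le h.hT.le]
    refine lip_prim (M := (2 * C) ^ m * (q * Real.exp ((q + m) * T))) (by positivity) hi ?_ _
    intro x hx
    refine (DD_bd h m q x hx.1).2.trans ?_
    gcongr
    exact hx.2
  · filter_upwards [LocallyIntegrable.ae_hasDerivAt_integral hi.locallyIntegrable] with x hx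
    rw [he]
    exact (hx 0).const_add _

lemma antidiag_assoc (m : ℕ) (F : ℕ → ℕ → ℕ → ℂ) :
    ∑ p ∈ Finset.HasAntidiagonal.antidiagonal m, ∑ r ∈ Finset.HasAntidiagonal.antidiagonal p.1, F r.1 r.2 p.2 =
    ∑ p ∈ Finset.HasAntidiagonal.antidiagonal m, ∑ r ∈ Finset.HasAntidiagonal.antidiagonal p.2, F p.1 r.1 r.2 := by
  rw [Finset.sum_sigma', Finset.sum_sigma']
  refine Finset.sum_nbij' (fun z => ⟨(z.2.1, z.2.2 + z.1.2), (z.2.2, z.1.2)⟩)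
    (fun z => ⟨(z.1.1 + z.2.1, z.2.2), (z.1.1, z.2.1)⟩) ?_ ?_ ?_ ?_ ?_
  · rintro ⟨⟨a, b⟩, ⟨c, d⟩⟩ h
    simp at h ⊢; omega
  · rintro ⟨⟨a, b⟩, ⟨c, d⟩⟩ h
    simp at h ⊢; omega
  · rintro ⟨⟨a, b⟩, ⟨c, d⟩⟩ h
    simp at h ⊢; omega
  · rintro ⟨⟨a, b⟩, ⟨c, d⟩⟩ h
    simp at h ⊢; omega
  · rintro ⟨⟨a, b⟩, ⟨c, d⟩⟩ h
    rfl

lemma dDD_mul_aux {m : ℕ} {b : ℕ → ℝ → ℂ} {x : ℝ} 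
    (ih : ∀ n < m + 1, ∀ q q', ∑ p ∈ Finset.HasAntidiagonal.antidiagonal n, DD b p.1 q x * DD b p.2 q' x
      = DD b n (q + q') x) (q q' : ℕ) :
    ∑ p ∈ Finset.HasAntidiagonal.antidiagonal m, dDD b (p.1 + 1) q x * DD b p.2 q' x
      = q * ∑ p ∈ Finset.HasAntidiagonal.antidiagonal m, b (p.1 + 1) x * DD b p.2 (q + q' + p.1 + 1) x := by
  have h1 : ∀ p ∈ Finset.HasAntidiagonal.antidiagonal m, b (p.1 + 1) x * DD b p.2 (q + q' + p.1 + 1) x =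
      ∑ r ∈ Finset.HasAntidiagonal.antidiagonal p.2, b (p.1 + 1) x * (DD b r.1 (q + p.1 + 1) x * DD b r.2 q' x) := by
    intro p hp
    have := Finset.HasAntidiagonal.mem_antidiagonal.1 hp
    rw [← Finset.mul_sum, ih p.2 (by omega)]
    congr 2; ring
  rw [Finset.sum_congr rfl h1,
    ← antidiag_assoc m (fun i j k => b (i + 1) x * (DD b j (q + i + 1) x * DD b k q' x))]
  simp only [dDD, Finset.mul_sum, Finset.sum_mul]
  refine Finset.sum_congr rfl fun p _ => Finset.sum_congr rfl fun r _ => ?_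
  ring

lemma dDD_mul {m : ℕ} {b : ℕ → ℝ → ℂ} {x : ℝ} 
    (ih : ∀ n < m, ∀ q q', ∑ p ∈ Finset.HasAntidiagonal.antidiagonal n, DD b p.1 q x * DD b p.2 q' x
      = DD b n (q + q') x) (q q' : ℕ) :
    ∑ p ∈ Finset.HasAntidiagonal.antidiagonal m,
      (dDD b p.1 q x * DD b p.2 q' x + DD b p.1 q x * dDD b p.2 q' x) = dDD b m (q + q') x := by
  cases m with
  | zero => simp [dDD]
  | succ m =>
    have e1 := dDD_mul_aux ih q q'
    have e2 := dDD_mul_aux ih q' q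
    rw [Finset.sum_add_distrib, Finset.Nat.sum_antidiagonal_succ,
      Finset.Nat.sum_antidiagonal_succ' (f := fun p => DD b p.1 q x * dDD b p.2 q' x)]
    rw [← Finset.Nat.sum_antidiagonal_swap] at e2
    simp only [Prod.fst_swap, Prod.snd_swap] at e2
    simp only [mul_comm (dDD b _ q' x)] at e2
    simp only [e1, e2, add_comm q' q]
    simp only [dDD]
    push_cast
    ring

lemma DD_mul {T C : ℝ} {b : ℕ → ℝ → ℂ} (h : Good T C b) (m : ℕ) :
    ∀ q q', ∀ x ∈ Set.Icc 0 T,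
      ∑ p ∈ Finset.HasAntidiagonal.antidiagonal m, DD b p.1 q x * DD b p.2 q' x = DD b m (q + q') x := by
  induction m using Nat.strong_induction_on with
  | _ m ih =>
    intro q q'
    have hP := Prim.sum (T := T) (Finset.HasAntidiagonal.antidiagonal m)
      fun p _ => (DD_prim h p.1 q).mul (DD_prim h p.2 q')
    refine Prim.unique h.hT hP (DD_prim h m (q + q')) ?_ ?_
    · intro x hx
      exact dDD_mul (fun n hn q q' => ih n hn q q' x hx) q q'
    · simp only [DD_at_zero]
      cases m with
      | zero => simp
      | succ m =>
        rw [Finset.Nat.sum_antidiagonal_succ]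
        simp

def RR : ℕ → List ℕ → ℂ
  | _, [] => 1
  | q, j :: L => q * RR (q + j) L

lemma pval_append (l : List ℕ) (j : ℕ) (t : ℂ) :
    pval (l ++ [j]) t = pval l t * (t - ((l.sum + j : ℕ) : ℂ) + 1) := by
  unfold pval
  rw [List.length_append, List.length_singleton, Finset.prod_range_succ]
  congr 1
  · refine Finset.prod_congr rfl fun i hi => ?_
    rw [Finset.mem_range] at hi
    rw [List.take_append_of_le_length (by omega)]
  · rw [List.take_of_length_le (by simp)]
    simp

lemma pval_rev (L : List ℕ) : ∀ q : ℕ, pval L.reverse ((L.sum : ℂ) + q - 1) = RR q L := by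
  induction L with
  | nil => intro q; simp [pval, RR]
  | cons j L ih =>
    intro q
    rw [List.reverse_cons, pval_append, RR, ← ih (q + j), mul_comm]
    congr 1
    · have : L.reverse.sum = L.sum := by simp
      rw [this, List.sum_cons, Nat.cast_add, Nat.cast_add]
      ring
    · rw [List.sum_cons, Nat.cast_add, Nat.cast_add]
      congr 1
      ring

lemma it_main {T C : ℝ} {b : ℕ → ℝ → ℂ} (h : Good T C b) (L : List ℕ) :
    (∀ i ∈ L, 0 < i) → Continuous (itIntAux b L) ∧
      ∀ i, Integrable (fun s => b (i + 1) s * itIntAux b L s) := by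
  have aux : ∀ L, Continuous (itIntAux b L) → 
      ∀ i, Integrable (fun s => b (i + 1) s * itIntAux b L s) := by
    intro L hc i
    have hs : Function.support (fun s => b (i + 1) s * itIntAux b L s) ⊆ Set.Icc 0 T := by
      intro x hx
      by_contra hn
      exact hx (by simp [h.van _ x hn])
    rw [← integrableOn_iff_integrable_of_support_subset hs]
    exact (b_intOn h i).mul_continuousOn (hc.continuousOn) isCompact_Icc
  intro hL
  suffices Continuous (itIntAux b L) from ⟨this, aux L this⟩
  induction L with
  | nil =>
    have : itIntAux b [] = fun _ => 1 := by ext; simp [itIntAux]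
    rw [this]; exact continuous_const
  | cons j L ih =>
    have h1 := ih (fun i hi => hL i (by simp [hi]))
    have hj := hL j (by simp)
    obtain ⟨i, rfl⟩ : ∃ i, j = i + 1 := ⟨j - 1, by omega⟩
    have : itIntAux b ((i+1) :: L) = fun x => ∫ s in (0:ℝ)..x, b (i+1) s * itIntAux b L s := by
      ext; simp [itIntAux]
    rw [this]
    exact intervalIntegral.continuous_primitive (fun _ _ => (aux L h1 i).intervalIntegrable) 0

lemma comp_sum (m : ℕ) (f : List ℕ → ℂ) :
    ∑ c : Composition (m + 1), f c.blocks =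
      ∑ p ∈ Finset.HasAntidiagonal.antidiagonal m, ∑ c : Composition p.2, f ((p.1 + 1) :: c.blocks) := by
  rw [Finset.sum_sigma']
  symm
  refine Finset.sum_bij (fun z hz => ⟨(z.1.1 + 1) :: z.2.blocks, ?_, ?_⟩) ?_ ?_ ?_ ?_
  · intro i hi
    rcases List.mem_cons.1 hi with rfl | hi
    · omega
    · exact z.2.blocks_pos hi
  · have := Finset.HasAntidiagonal.mem_antidiagonal.1 (Finset.mem_sigma.1 hz).1
    simp; omega
  · intros; simp
  · rintro ⟨⟨a, n⟩, c⟩ hz ⟨⟨a', n'⟩, c'⟩ hz' he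
    simp only [Composition.mk.injEq, List.cons.injEq] at he
    simp at hz hz'
    have h1 : a = a' := by omega
    have h2 : n = n' := by omega
    subst h1 h2
    have : c = c' := Composition.ext he.2
    rw [this]
  · rintro ⟨l, hl, hs⟩ -
    cases l with
    | nil => simp at hs
    | cons j l =>
      have hj : 0 < j := hl (by simp)
      simp at hs
      refine ⟨⟨(j - 1, l.sum), ⟨l, fun hi => hl (by simp [hi]), rfl⟩⟩, ?_, ?_⟩
      · simp; omega
      · apply Composition.ext
        change (j - 1 + 1) :: l = j :: l
        rw [Nat.sub_add_cancel hj]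
  · intros; rfl

lemma DD_comp {T C : ℝ} {b : ℕ → ℝ → ℂ} (h : Good T C b) (m : ℕ) :
    ∀ q x, DD b m q x = ∑ c : Composition m, RR q c.blocks * itIntAux b c.blocks x := by
  induction m using Nat.strong_induction_on with
  | _ m ih =>
    intro q x
    cases m with
    | zero =>
      rw [DD_zero, Finset.sum_eq_single (default : Composition 0)]
      · have : (default : Composition 0).blocks = [] := by rw [Composition.blocks_eq_nil]
        rw [this]; simp [RR, itIntAux]
      · intro c _ hc
        exact absurd (Composition.ext (by
          rw [(Composition.blocks_eq_nil c).2 rfl, (Composition.blocks_eq_nil _).2 rfl])) hc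
      · simp
    | succ m =>
      rw [comp_sum m (fun l => RR q l * itIntAux b l x), DD_succ]
      have e : ∀ s, dDD b (m+1) q s = ∑ p ∈ Finset.HasAntidiagonal.antidiagonal m,
          ∑ c : Composition p.2, RR q ((p.1 + 1) :: c.blocks) *
            (b (p.1 + 1) s * itIntAux b c.blocks s) := by
        intro s
        rw [dDD, Finset.mul_sum]
        refine Finset.sum_congr rfl fun p hp => ?_
        have := Finset.HasAntidiagonal.mem_antidiagonal.1 hp
        rw [ih p.2 (by omega), Finset.mul_sum, Finset.mul_sum]
        refine Finset.sum_congr rfl fun c _ => ?_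
        rw [RR, add_assoc]
        ring
      simp only [e]
      have hint : ∀ (p : ℕ × ℕ) (c : Composition p.2), IntervalIntegrable
          (fun s => RR q ((p.1 + 1) :: c.blocks) *
            (b (p.1 + 1) s * itIntAux b c.blocks s)) volume 0 x := fun p c =>
        (((it_main h c.blocks (fun i hi => c.blocks_pos hi)).2 p.1).const_mul _).intervalIntegrable
      rw [intervalIntegral.integral_finsetSum]
      · refine Finset.sum_congr rfl fun p hp => ?_
        rw [intervalIntegral.integral_finsetSum (fun c _ => hint p c)]
        refine Finset.sum_congr rfl fun c _ => ?_
        rw [intervalIntegral.integral_const_mul, itIntAux]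
      · intro p _
        have := IntervalIntegrable.sum Finset.univ (fun c _ => hint p c)
        convert! this using 1
        ext s; simp

lemma returnCoeff_eq {T C : ℝ} {b : ℕ → ℝ → ℂ} (h : Good T C b) (m : ℕ) :
    returnCoeff T b m = DD b m 1 T := by
  rw [DD_comp h, returnCoeff]
  refine Finset.sum_bij (fun c _ => c.reverse) (by simp) ?_ ?_ ?_
  · intro c _ c' _ he
    have := congrArg Composition.reverse he
    simpa using this
  · intro c _
    exact ⟨c.reverse, by simp, by simp⟩
  · intro c _
    rw [itInt, ← pval_rev]
    have : c.reverse.blocks = c.blocks.reverse := rfl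
    rw [this]
    simp

lemma itIntAux_congr {T : ℝ} {a b : ℕ → ℝ → ℂ} (hab : ∀ i, ∀ x ∈ Set.Icc 0 T, a i x = b i x)
    (L : List ℕ) : ∀ x ∈ Set.Icc 0 T, itIntAux a L x = itIntAux b L x := by
  induction L with
  | nil => intros; simp [itIntAux]
  | cons j L ih =>
    intro x hx
    rw [itIntAux, itIntAux]
    apply intervalIntegral.integral_congr
    intro s hs
    rw [Set.uIcc_of_le hx.1] at hs
    have hs' : s ∈ Set.Icc 0 T := ⟨hs.1, hs.2.trans hx.2⟩
    simp only [hab j s hs', ih s hs']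

lemma returnCoeff_congr {T : ℝ} (hT : 0 < T) {a b : ℕ → ℝ → ℂ}
    (hab : ∀ i, ∀ x ∈ Set.Icc 0 T, a i x = b i x) (m : ℕ) :
    returnCoeff T a m = returnCoeff T b m := by
  unfold returnCoeff itInt
  refine Finset.sum_congr rfl fun c _ => ?_
  rw [itIntAux_congr hab _ T ⟨hT.le, le_rfl⟩]

lemma isODESol_congr {T : ℝ} {a b : ℕ → ℝ → ℂ}
    (hab : ∀ i, ∀ x ∈ Set.Icc 0 T, a i x = b i x) {v : ℝ → ℂ} (h : IsODESol T a v) :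
    IsODESol T b v := by
  refine ⟨h.1, ?_⟩
  have h2 := h.2
  rw [ae_restrict_iff' measurableSet_Icc] at h2 ⊢
  filter_upwards [h2] with x hx hxI
  have := hx hxI
  simp only [hab _ x hxI] at this
  exact this

lemma mv_aux {u : ℝ → ℂ} {p q B : ℝ} {K : NNReal} (hpq : p ≤ q)
    (hu : LipschitzOnWith K u (Set.Icc p q))
    (hd : ∀ᵐ s, s ∈ Set.Icc p q → ∃ d, HasDerivAt u d s ∧ ‖d‖ ≤ B) 
    (L : ℂ →L[ℝ] ℝ) (hL : ∀ z, |L z| ≤ ‖z‖) : |L (u q) - L (u p)| ≤ B * (q - p) := by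
  have hlip : LipschitzOnWith (‖L‖₊ * K) (fun s => L (u s)) (Set.uIcc p q) := by
    rw [Set.uIcc_of_le hpq]
    exact L.lipschitz.comp_lipschitzOnWith hu
  have h1 := hlip.absolutelyContinuousOnInterval.integral_deriv_eq_sub
  rw [← h1, ← Real.norm_eq_abs, ← abs_of_nonneg (sub_nonneg.2 hpq)]
  apply intervalIntegral.norm_integral_le_of_norm_le_const_ae
  filter_upwards [hd] with s hs hsI
  have hsI' : s ∈ Set.Icc p q := by
    have := Set.uIoc_subset_uIcc hsI
    rwa [Set.uIcc_of_le hpq] at this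
  obtain ⟨d, h2, h3⟩ := hs hsI'
  have h4 : HasDerivAt (fun s => L (u s)) (L d) s := L.hasFDerivAt.comp_hasDerivAt s h2
  rw [h4.deriv]
  exact (hL d).trans h3

lemma mv {u : ℝ → ℂ} {p q B : ℝ} {K : NNReal} (hpq : p ≤ q)
    (hu : LipschitzOnWith K u (Set.Icc p q))
    (hd : ∀ᵐ s, s ∈ Set.Icc p q → ∃ d, HasDerivAt u d s ∧ ‖d‖ ≤ B) :
    ‖u q - u p‖ ≤ 2 * B * (q - p) := by
  have h1 := mv_aux hpq hu hd Complex.reCLM Complex.abs_re_le_norm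
  have h2 := mv_aux hpq hu hd Complex.imCLM Complex.abs_im_le_norm
  have h3 := Complex.norm_le_abs_re_add_abs_im (u q - u p)
  simp only [Complex.sub_re, Complex.sub_im] at h3
  simp only [Complex.reCLM_apply, Complex.imCLM_apply] at h1 h2
  linarith

lemma pow_diff {z w : ℂ} {ρ : ℝ} (hz : ‖z‖ ≤ ρ) (hw : ‖w‖ ≤ ρ) (n : ℕ) :
    ‖z ^ (n + 1) - w ^ (n + 1)‖ ≤ (n + 1) * ρ ^ n * ‖z - w‖ := by
  have hρ : 0 ≤ ρ := (norm_nonneg _).trans hz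
  induction n with
  | zero => simp
  | succ n ih =>
    have e : z ^ (n + 1 + 1) - w ^ (n + 1 + 1) = z * (z ^ (n + 1) - w ^ (n + 1)) + (z - w) * w ^ (n + 1) := by
      ring
    rw [e]
    calc _ ≤ ‖z‖ * ‖z ^ (n + 1) - w ^ (n + 1)‖ + ‖z - w‖ * ‖w‖ ^ (n + 1) := by
          refine (norm_add_le _ _).trans ?_
          rw [norm_mul, norm_mul, norm_pow]
      _ ≤ ρ * ((n + 1) * ρ ^ n * ‖z - w‖) + ‖z - w‖ * ρ ^ (n + 1) := by gcongr
      _ = _ := by push_cast; ring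

lemma summable_L : Summable (fun j : ℕ => ((j : ℝ) + 2) * (1 / 2 : ℝ) ^ (j + 1)) := by
  have h1 : Summable (fun j : ℕ => ((j : ℝ)) ^ 1 * (1 / 2 : ℝ) ^ j) :=
    summable_pow_mul_geometric_of_norm_lt_one 1 (by norm_num)
  have h2 : Summable (fun j : ℕ => (1 / 2 : ℝ) ^ j) :=
    summable_geometric_of_norm_lt_one (by norm_num)
  convert! (h1.mul_right (1/2)).add h2 using 1
  ext j
  rw [pow_succ]
  ring

def LL : ℝ := ∑' j : ℕ, ((j : ℝ) + 2) * (1 / 2 : ℝ) ^ (j + 1)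

lemma LL_nonneg : 0 ≤ LL := tsum_nonneg fun j => by positivity

lemma rhs_summable {T C : ℝ} {b : ℕ → ℝ → ℂ} (h : Good T C b) (x : ℝ) {z : ℂ} (hz : ‖z‖ ≤ 1 / (2 * C)) :
    Summable fun i : ℕ => ‖b (i + 1) x * z ^ (i + 2)‖ := by
  have hC := h.hC
  have h0 : Summable (fun j : ℕ => (1 / 2 : ℝ) ^ j) := summable_geometric_of_norm_lt_one (by norm_num)
  have h2 : Summable (fun j : ℕ => (1 / 2 : ℝ) ^ j * (1 / 2 * (1 / (2 * C)))) := h0.mul_right _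
  refine Summable.of_nonneg_of_le (fun _ => norm_nonneg _) (fun i => ?_) h2
  rw [norm_mul, norm_pow]
  have hh : C * (1 / (2 * C)) = 1 / 2 := by field_simp
  calc ‖b (i + 1) x‖ * ‖z‖ ^ (i + 2) ≤ C ^ (i + 1) * (1 / (2 * C)) ^ (i + 2) :=
        mul_le_mul (h.bd _ _) (pow_le_pow_left₀ (norm_nonneg _) hz _) (by positivity) (by positivity)
    _ = (C * (1 / (2 * C))) ^ (i + 1) * (1 / (2 * C)) := by
        rw [mul_pow]; ring
    _ = (1 / 2 : ℝ) ^ i * (1 / 2 * (1 / (2 * C))) := by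
        rw [hh, pow_succ, mul_assoc]

lemma rhs_lip {T C : ℝ} {b : ℕ → ℝ → ℂ} (h : Good T C b) (x : ℝ) {z w : ℂ} (hz : ‖z‖ ≤ 1 / (2 * C))
    (hw : ‖w‖ ≤ 1 / (2 * C)) :
    ‖∑' i : ℕ, b (i + 1) x * z ^ (i + 2) - ∑' i : ℕ, b (i + 1) x * w ^ (i + 2)‖ ≤ LL * ‖z - w‖ := by
  have hC := h.hC
  rw [← (rhs_summable h x hz).of_norm.tsum_sub (rhs_summable h x hw).of_norm, LL, ← tsum_mul_right]
  refine tsum_of_norm_bounded (summable_L.mul_right _).hasSum fun i => ?_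
  rw [← mul_sub, norm_mul]
  calc _ ≤ C ^ (i + 1) * (((i + 1 : ℕ) + 1) * (1 / (2 * C)) ^ (i + 1) * ‖z - w‖) := by
        gcongr
        · exact h.bd _ _
        · exact pow_diff hz hw (i + 1)
    _ = ((i : ℝ) + 2) * (C * (1 / (2 * C))) ^ (i + 1) * ‖z - w‖ := by
        rw [mul_pow]; push_cast; ring
    _ = _ := by
        have : C * (1 / (2 * C)) = 1 / 2 := by field_simp
        rw [this]

lemma ode_unique {T C : ℝ} {b : ℕ → ℝ → ℂ} (h : Good T C b) {v w : ℝ → ℂ}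
    (hv : IsODESol T b v) (hw : IsODESol T b w) (h0 : w 0 = v 0)
    (hb : ∀ x ∈ Set.Icc 0 T, ‖v x‖ < 1 / (2 * C)) : Set.EqOn w v (Set.Icc 0 T) := by
  obtain ⟨⟨Kv, hKv⟩, hv2⟩ := hv
  obtain ⟨⟨Kw, hKw⟩, hw2⟩ := hw
  rw [ae_restrict_iff' measurableSet_Icc] at hv2 hw2
  have hLL := LL_nonneg
  have hsub : Set.Icc 0 T ⊆ {t | w t = v t} := by
    apply IsClosed.Icc_subset_of_forall_exists_gt
    · have : {t | w t = v t} ∩ Set.Icc 0 T = Set.Icc 0 T ∩ (fun t => w t - v t) ⁻¹' {0} := by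
        ext t; simp [sub_eq_zero, and_comm]
      rw [this]
      exact (hKw.continuousOn.sub hKv.continuousOn).preimage_isClosed_of_isClosed isClosed_Icc
        isClosed_singleton
    · exact h0
    · rintro x ⟨hx, hx0, hxT⟩ y hy
      have hxI : x ∈ Set.Icc 0 T := ⟨hx0, hxT.le⟩
      have hy : x < y := hy
      have hwx : ‖w x‖ < 1 / (2 * C) := by
        have : w x = v x := hx
        rw [this]; exact hb x hxI
      have hev : ∀ᶠ s in nhdsWithin x (Set.Icc 0 T), ‖w s‖ < 1 / (2 * C) :=
        (hKw.continuousOn x hxI).norm.eventually (gt_mem_nhds hwx)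
      obtain ⟨δ, hδ, hδ'⟩ := Metric.mem_nhdsWithin_iff.1 hev
      obtain ⟨x1, hx1, hx1'⟩ : ∃ x1, x < x1 ∧ x1 < min (min y T) (min (x + δ) (x + 1 / (4 * (LL + 1)))) := by
        apply exists_between
        have : 0 < 1 / (4 * (LL + 1)) := by positivity
        simp only [lt_min_iff]
        exact ⟨⟨hy, hxT⟩, by linarith, by linarith⟩
      simp only [lt_min_iff] at hx1'
      obtain ⟨⟨h1, h2⟩, h3, h4⟩ := hx1'
      have hJ : Set.Icc x x1 ⊆ Set.Icc 0 T := Set.Icc_subset_Icc hx0 h2.le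
      have hLu : LipschitzOnWith (Kw + Kv) (fun s => w s - v s) (Set.Icc x x1) := 
        (hKw.mono hJ).sub (hKv.mono hJ)
      obtain ⟨ξ, hξ, hmax⟩ := isCompact_Icc.exists_isMaxOn (Set.nonempty_Icc.2 hx1.le)
        hLu.continuousOn.norm
      have hmv : ‖(w ξ - v ξ) - (w x - v x)‖ ≤ 2 * (LL * ‖w ξ - v ξ‖) * (ξ - x) := by
        refine mv (u := fun s => w s - v s) hξ.1 (hLu.mono (Set.Icc_subset_Icc_right hξ.2)) ?_
        filter_upwards [hv2, hw2] with s hs hs' hsI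
        have hsJ : s ∈ Set.Icc x x1 := ⟨hsI.1, hsI.2.trans hξ.2⟩
        refine ⟨_, (hs' (hJ hsJ)).2.sub (hs (hJ hsJ)).2, ?_⟩
        have hws : ‖w s‖ < 1 / (2 * C) := by
          apply hδ'
          refine ⟨?_, hJ hsJ⟩
          rw [Metric.mem_ball, Real.dist_eq, abs_of_nonneg (by linarith [hsJ.1])]
          linarith [hsJ.2]
        refine (rhs_lip h s hws.le (hb s (hJ hsJ)).le).trans ?_
        gcongr
        exact hmax hsJ
      have e : w x - v x = 0 := sub_eq_zero.2 hx
      rw [e, sub_zero] at hmv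
      have h5 : ξ - x ≤ 1 / (4 * (LL + 1)) := by linarith [hξ.2]
      have h6 : LL * (ξ - x) ≤ 1 / 4 := by
        calc LL * (ξ - x) ≤ LL * (1 / (4 * (LL + 1))) := by gcongr
          _ ≤ (LL + 1) * (1 / (4 * (LL + 1))) := by gcongr; linarith
          _ = 1 / 4 := by field_simp
      have h7 : ‖w ξ - v ξ‖ ≤ 0 := by nlinarith [norm_nonneg (w ξ - v ξ)]
      refine ⟨x1, ?_, hx1, h1.le⟩
      have h8 : ‖w x1 - v x1‖ ≤ ‖w ξ - v ξ‖ := hmax ⟨hx1.le, le_rfl⟩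
      exact sub_eq_zero.1 (norm_le_zero_iff.1 (h8.trans h7))
  exact hsub

structure SmallR (T C : ℝ) (r : ℂ) : Prop where
  lt : 2 * C * (Real.exp T * ‖r‖) < 1 / 2

def zz (T : ℝ) (r : ℂ) : ℝ := Real.exp T * ‖r‖

lemma zz_nonneg (T : ℝ) (r : ℂ) : 0 ≤ zz T r := by unfold zz; positivity

lemma pow_rw (T C : ℝ) (r : ℂ) (m q : ℕ) :
    (2 * C) ^ m * Real.exp (((q : ℝ) + m) * T) * ‖r‖ ^ (m + q) = zz T r ^ q * (2 * C * zz T r) ^ m := by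
  have : Real.exp (((q : ℝ) + m) * T) = Real.exp T ^ (m + q) := by
    rw [← Real.exp_nat_mul]; push_cast; ring_nf
  rw [this, zz]
  ring

lemma DD_bd' {T C : ℝ} {b : ℕ → ℝ → ℂ} (h : Good T C b) (m q : ℕ) {x : ℝ} (hx : x ∈ Set.Icc 0 T) :
    ‖DD b m q x‖ ≤ (2 * C) ^ m * Real.exp ((q + m) * T) ∧
      ‖dDD b m q x‖ ≤ q * ((2 * C) ^ m * Real.exp ((q + m) * T)) := by
  have hC := h.hC
  obtain ⟨h1, h2⟩ := DD_bd h m q x hx.1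
  have : Real.exp (((q : ℝ) + m) * x) ≤ Real.exp ((q + m) * T) := by
    gcongr
    exact hx.2
  constructor
  · exact h1.trans (by gcongr)
  · calc _ ≤ _ := h2
      _ ≤ (2 * C) ^ m * (q * Real.exp ((q + m) * T)) := by gcongr
      _ = _ := by ring

lemma term_bd {T C : ℝ} {b : ℕ → ℝ → ℂ} (h : Good T C b) (r : ℂ) (hr : SmallR T C r)
    (m q : ℕ) {x : ℝ} (hx : x ∈ Set.Icc 0 T) :
    ‖DD b m q x * r ^ (m + q)‖ ≤ zz T r ^ q * (1 / 2) ^ m := by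
  have hC := h.hC
  have hz := zz_nonneg T r
  rw [norm_mul, norm_pow]
  calc _ ≤ (2 * C) ^ m * Real.exp (((q : ℝ) + m) * T) * ‖r‖ ^ (m + q) := by
        gcongr
        exact (DD_bd' h m q hx).1
    _ = _ := pow_rw T C r m q
    _ ≤ _ := by
        gcongr
        exact hr.lt.le

def VV (b : ℕ → ℝ → ℂ) (r : ℂ) (q : ℕ) (x : ℝ) : ℂ := ∑' m, DD b m q x * r ^ (m + q)

lemma geo_summable (c : ℝ) : Summable (fun m : ℕ => c * (1 / 2 : ℝ) ^ m) :=
  (summable_geometric_of_norm_lt_one (by norm_num : ‖(1/2:ℝ)‖ < 1)).mul_left c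

lemma VV_summable {T C : ℝ} {b : ℕ → ℝ → ℂ} (h : Good T C b) (r : ℂ) (hr : SmallR T C r)
    (q : ℕ) {x : ℝ} (hx : x ∈ Set.Icc 0 T) : Summable fun m => ‖DD b m q x * r ^ (m + q)‖ :=
  Summable.of_nonneg_of_le (fun _ => norm_nonneg _) (fun m => term_bd h r hr m q hx) (geo_summable _)

lemma VV_mul {T C : ℝ} {b : ℕ → ℝ → ℂ} (h : Good T C b) (r : ℂ) (hr : SmallR T C r)
    (q q' : ℕ) {x : ℝ} (hx : x ∈ Set.Icc 0 T) : VV b r q x * VV b r q' x = VV b r (q + q') x := by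
  unfold VV
  rw [tsum_mul_tsum_eq_tsum_sum_antidiagonal_of_summable_norm (VV_summable h r hr q hx)
    (VV_summable h r hr q' hx)]
  congr 1
  ext m
  rw [← DD_mul h m q q' x hx, Finset.sum_mul]
  refine Finset.sum_congr rfl fun p hp => ?_
  rw [← Finset.HasAntidiagonal.mem_antidiagonal.1 hp]
  ring

lemma VV_pow {T C : ℝ} {b : ℕ → ℝ → ℂ} (h : Good T C b) (r : ℂ) (hr : SmallR T C r)
    (q : ℕ) {x : ℝ} (hx : x ∈ Set.Icc 0 T) : VV b r (q + 1) x = VV b r 1 x ^ (q + 1) := by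
  induction q with
  | zero => simp
  | succ q ih => rw [← VV_mul h r hr (q + 1) 1 hx, ih]; ring

lemma VV_norm {T C : ℝ} {b : ℕ → ℝ → ℂ} (h : Good T C b) (r : ℂ) (hr : SmallR T C r)
    {x : ℝ} (hx : x ∈ Set.Icc 0 T) : ‖VV b r 1 x‖ < 1 / (2 * C) := by
  have hC := h.hC
  have h1 : ‖VV b r 1 x‖ ≤ zz T r * 2 := by
    have hs : HasSum (fun m : ℕ => zz T r ^ 1 * (1 / 2 : ℝ) ^ m) (zz T r * 2) := by
      have := hasSum_geometric_two.mul_left (zz T r)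
      simpa using this
    exact tsum_of_norm_bounded hs fun m => term_bd h r hr m 1 hx
  refine h1.trans_lt ?_
  have := hr.lt
  rw [lt_div_iff₀ (by positivity)]
  unfold zz
  linarith

def gg (b : ℕ → ℝ → ℂ) (r : ℂ) (s : ℝ) : ℂ := ∑' m, dDD b (m + 1) 1 s * r ^ (m + 2)

lemma gg_term_bd {T C : ℝ} {b : ℕ → ℝ → ℂ} (h : Good T C b) (r : ℂ) (hr : SmallR T C r)
    (m : ℕ) (x : ℝ) : ‖dDD b (m + 1) 1 x * r ^ (m + 2)‖ ≤ zz T r * (1 / 2) ^ m := by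
  have hC := h.hC
  have hz := zz_nonneg T r
  by_cases hx : x ∈ Set.Icc 0 T
  · rw [norm_mul, norm_pow]
    have h1 := (DD_bd' h (m + 1) 1 hx).2
    rw [Nat.cast_one, one_mul] at h1
    have h2 := pow_rw T C r (m + 1) 1
    rw [Nat.cast_one] at h2
    calc _ ≤ (2 * C) ^ (m + 1) * Real.exp ((1 + (m + 1 : ℕ)) * T) * ‖r‖ ^ (m + 1 + 1) := by
          gcongr
      _ = _ := h2
      _ ≤ zz T r ^ 1 * (1 / 2) ^ (m + 1) := by
          gcongr
          exact hr.lt.le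
      _ ≤ _ := by
          rw [pow_one, pow_succ]
          gcongr
          have : (0:ℝ) ≤ (1/2)^m := by positivity
          linarith
  · rw [dDD_van h _ _ x hx]
    simp only [zero_mul, norm_zero]
    positivity

lemma gg_hasSum {T C : ℝ} {b : ℕ → ℝ → ℂ} (h : Good T C b) (r : ℂ) (hr : SmallR T C r) (x : ℝ) :
    HasSum (fun m => dDD b (m + 1) 1 x * r ^ (m + 2)) (gg b r x) :=
  (Summable.of_norm_bounded (geo_summable _) (fun m => gg_term_bd h r hr m x)).hasSum

lemma gg_bd {T C : ℝ} {b : ℕ → ℝ → ℂ} (h : Good T C b) (r : ℂ) (hr : SmallR T C r) (x : ℝ) :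
    ‖gg b r x‖ ≤ zz T r * 2 :=
  tsum_of_norm_bounded (hasSum_geometric_two.mul_left (zz T r)) fun m => gg_term_bd h r hr m x

lemma gg_integrable {T C : ℝ} {b : ℕ → ℝ → ℂ} (h : Good T C b) (r : ℂ) (hr : SmallR T C r) :
    Integrable (gg b r) := by
  have hm : AEStronglyMeasurable (gg b r) volume := by
    refine aestronglyMeasurable_of_tendsto_ae Filter.atTop
      (f := fun n x => ∑ m ∈ Finset.range n, dDD b (m + 1) 1 x * r ^ (m + 2)) ?_ ?_
    · intro n
      apply Integrable.aestronglyMeasurable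
      apply integrable_finsetSum
      intro m _
      exact (DD_main h (m + 1) 1).2.mul_const _
    · exact Filter.Eventually.of_forall fun x => (gg_hasSum h r hr x).tendsto_sum_nat
  have hs : Function.support (gg b r) ⊆ Set.Icc 0 T := by
    intro x hx
    by_contra hn
    apply hx
    simp [gg, dDD_van h _ _ x hn]
  rw [← integrableOn_iff_integrable_of_support_subset hs]
  exact Measure.integrableOn_of_bounded (M := zz T r * 2) (by simp) hm
    (Filter.Eventually.of_forall (gg_bd h r hr))

lemma gg_integral {T C : ℝ} {b : ℕ → ℝ → ℂ} (h : Good T C b) (r : ℂ) (hr : SmallR T C r) (x : ℝ) :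
    HasSum (fun m => DD b (m + 1) 1 x * r ^ (m + 2)) (∫ s in (0:ℝ)..x, gg b r s) := by
  have := intervalIntegral.hasSum_integral_of_dominated_convergence (a := 0) (b := x) (μ := volume)
    (F := fun m s => dDD b (m + 1) 1 s * r ^ (m + 2)) (f := gg b r)
    (fun m _ => zz T r * (1 / 2) ^ m)
    (fun m => ((DD_main h (m + 1) 1).2.mul_const _).aestronglyMeasurable.restrict)
    (fun m => Filter.Eventually.of_forall fun s _ => gg_term_bd h r hr m s)
    (Filter.Eventually.of_forall fun s _ => geo_summable _)
    (by simp)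
    (Filter.Eventually.of_forall fun s _ => gg_hasSum h r hr s)
  convert! this using 1
  ext m
  rw [intervalIntegral.integral_mul_const, DD_succ]

lemma VV_eq {T C : ℝ} {b : ℕ → ℝ → ℂ} (h : Good T C b) (r : ℂ) (hr : SmallR T C r) 
    {x : ℝ} (hx : x ∈ Set.Icc 0 T) : VV b r 1 x = r + ∫ s in (0:ℝ)..x, gg b r s := by
  rw [← (gg_integral h r hr x).tsum_eq, VV, (VV_summable h r hr 1 hx).of_norm.tsum_eq_zero_add]
  simp [DD_zero, add_assoc]

lemma gg_eq {T C : ℝ} {b : ℕ → ℝ → ℂ} (h : Good T C b) (r : ℂ) (hr : SmallR T C r) 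
    {x : ℝ} (hx : x ∈ Set.Icc 0 T) :
    gg b r x = ∑' j : ℕ, b (j + 1) x * VV b r 1 x ^ (j + 2) := by
  have hC := h.hC
  have hz := zz_nonneg T r
  let f : ℕ × ℕ → ℂ := fun p => b (p.1 + 1) x * (DD b p.2 (p.1 + 2) x * r ^ (p.2 + (p.1 + 2)))
  have hf : Summable f := by
    have h1 := (geo_summable (zz T r)).mul_of_nonneg (geo_summable 1) 
      (fun m => by positivity) (fun m => by positivity)
    refine Summable.of_norm_bounded h1 ?_
    rintro ⟨j, n⟩
    simp only [f]
    rw [norm_mul]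
    have hcz : C * zz T r ≤ 1 / 2 := by
      have := hr.lt
      unfold zz
      have : 0 ≤ C * (Real.exp T * ‖r‖) := by positivity
      linarith
    calc _ ≤ C ^ (j + 1) * (zz T r ^ (j + 2) * (1 / 2) ^ n) := by
          gcongr
          · exact h.bd _ _
          · exact term_bd h r hr n (j + 2) hx
      _ = zz T r * (C * zz T r) ^ (j + 1) * (1 / 2) ^ n := by ring
      _ ≤ zz T r * (1 / 2) ^ (j + 1) * (1 / 2) ^ n := by gcongr
      _ ≤ _ := by
          rw [one_mul, pow_succ]
          have : (0:ℝ) ≤ (1/2)^j := by positivity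
          gcongr
          linarith
  have e1 : ∑' p, f p = ∑' j : ℕ, b (j + 1) x * VV b r 1 x ^ (j + 2) := by
    rw [hf.tsum_prod]
    congr 1
    ext j
    simp only [f]
    rw [tsum_mul_left, ← VV_pow h r hr (j + 1) hx]
    rfl
  rw [← e1, ← Finset.HasAntidiagonal.sigmaAntidiagonalEquivProd.tsum_eq f]
  have hf' : Summable (fun c : (n : ℕ) × ↥(Finset.HasAntidiagonal.antidiagonal n) => f (Finset.HasAntidiagonal.sigmaAntidiagonalEquivProd c)) := (Finset.HasAntidiagonal.sigmaAntidiagonalEquivProd (A := ℕ)).summable_iff.2 hf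
  rw [Summable.tsum_sigma' (fun n => Summable.of_finite) hf']
  unfold gg
  congr 1
  ext m
  rw [tsum_fintype, dDD, Nat.cast_one, one_mul, Finset.sum_mul, ← Finset.sum_coe_sort]
  refine Finset.sum_congr rfl ?_
  rintro ⟨⟨j, n⟩, hp⟩ _
  simp only [f, Finset.HasAntidiagonal.sigmaAntidiagonalEquivProd, Equiv.coe_fn_mk]
  have := Finset.HasAntidiagonal.mem_antidiagonal.1 hp
  simp only at this
  rw [← this, mul_assoc, show 1 + j + 1 = j + 2 by ring, show n + (j + 2) = j + n + 2 by ring]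

lemma main_good {T C : ℝ} {b : ℕ → ℝ → ℂ} (h : Good T C b) (r : ℂ) (hr : SmallR T C r) :
      ∃ v : ℝ → ℂ, v 0 = r ∧ IsODESol T b v ∧
        (∀ w : ℝ → ℂ, w 0 = r → IsODESol T b w → Set.EqOn w v (Set.Icc 0 T)) ∧
        (Summable fun i : ℕ => ‖returnCoeff T b (i + 1) * r ^ (i + 2)‖) ∧
        v T = r + ∑' i : ℕ, returnCoeff T b (i + 1) * r ^ (i + 2) := by
  have hTI : T ∈ Set.Icc 0 T := ⟨h.hT.le, le_rfl⟩
  have hz := zz_nonneg T r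
  have hsol : IsODESol T b (fun x => r + ∫ s in (0:ℝ)..x, gg b r s) := by
    refine ⟨⟨_, lip_prim (M := zz T r * 2) (by positivity) (gg_integrable h r hr)
      (fun x _ => gg_bd h r hr x) r⟩, ?_⟩
    rw [ae_restrict_iff' measurableSet_Icc]
    filter_upwards [LocallyIntegrable.ae_hasDerivAt_integral
      (gg_integrable h r hr).locallyIntegrable] with x hx hxI
    have hd := (hx 0).const_add r
    rw [gg_eq h r hr hxI] at hd
    simp only [← VV_eq h r hr hxI]
    exact ⟨rhs_summable h x (VV_norm h r hr hxI).le, hd⟩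
  refine ⟨_, by simp, hsol, ?_, ?_, ?_⟩
  · intro w hw0 hw
    refine ode_unique h hsol hw (by simp [hw0]) ?_
    intro x hx
    simp only [← VV_eq h r hr hx]
    exact VV_norm h r hr hx
  · simp only [returnCoeff_eq h]
    exact (gg_integral h r hr T).summable.norm
  · simp only [returnCoeff_eq h]
    rw [(gg_integral h r hr T).tsum_eq]

/-- expansion of the first return map: for `|r|` small enough, the Lipschitz
solution `v(·;r;a)` exists on `[0,T]` and
`v(T;r;a) = r + ∑_{i≥1} cᵢ(a) r^{i+1}`, the series converging absolutely. -/
theorem first_return_map_expansion (T : ℝ) (hT : 0 < T) (a : ℕ → ℝ → ℂ) (ha : MemX T a) :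
    ∃ ε > (0 : ℝ), ∀ r : ℂ, ‖r‖ < ε →
      ∃ v : ℝ → ℂ, v 0 = r ∧ IsODESol T a v ∧
        (∀ w : ℝ → ℂ, w 0 = r → IsODESol T a w → Set.EqOn w v (Set.Icc 0 T)) ∧
        (Summable fun i : ℕ => ‖returnCoeff T a (i + 1) * r ^ (i + 2)‖) ∧
        v T = r + ∑' i : ℕ, returnCoeff T a (i + 1) * r ^ (i + 2) := by

  obtain ⟨hm, C, hC⟩ := ha
  let C' := max C 1
  have hC0 : 0 ≤ C := by
    have := (norm_nonneg _).trans (hC 1 le_rfl 0 ⟨le_rfl, hT.le⟩)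
    simpa using this
  have hC1 : 1 ≤ C' := le_max_right _ _
  let b : ℕ → ℝ → ℂ := fun i => (Set.Icc 0 T).indicator (a i)
  have hab : ∀ i, ∀ x ∈ Set.Icc 0 T, a i x = b i x := by
    intro i x hx
    simp only [b, Set.indicator_of_mem hx]
  have hg : Good T C' b := by
    refine ⟨hT, hC1, fun i => (hm i).indicator measurableSet_Icc, ?_, ?_⟩
    · intro i x
      by_cases hx : x ∈ Set.Icc 0 T
      · rw [← hab _ x hx]
        exact (hC (i + 1) (by omega) x hx).trans (pow_le_pow_left₀ hC0 (le_max_left _ _) _)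
      · simp only [b, Set.indicator_of_notMem hx, norm_zero]
        positivity
    · intro i x hx
      simp only [b, Set.indicator_of_notMem hx]
  refine ⟨1 / (4 * C' * Real.exp T), by positivity, fun r hr => ?_⟩
  have hs : SmallR T C' r := by
    constructor
    rw [lt_div_iff₀ (by positivity)] at hr
    linarith
  obtain ⟨v, h1, h2, h3, h4, h5⟩ := main_good hg r hs
  have hab' : ∀ i, ∀ x ∈ Set.Icc 0 T, b i x = a i x := fun i x hx => (hab i x hx).symm
  refine ⟨v, h1, isODESol_congr hab' h2, fun w hw0 hw => h3 w hw0 (isODESol_congr hab hw), ?_, ?_⟩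
  · simpa only [returnCoeff_congr hT hab] using h4
  · simpa only [returnCoeff_congr hT hab] using h5
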